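/- arXiv:2412.11743 — 3 statements merged into one kernel-verified Lean document; each statement's English description precedes it below -/
import Mathlib

section
/- Under the stated assumptions (prior conditions on π, the quadratic representation (M1), and the separation condition (M2)), the generalized posterior concentrates at θ*: for every ε > 0, ∫_{B_ε(θ*)} π_T(θ) dθ → 1 as T → ∞, where B_ε(θ*) = {θ ∈ ℝ^p : ‖θ − θ*‖ < ε}. -/
open Filter Topology MeasureTheory

/-- **Theorem 1, part (i)** (Bernstein–von Mises: posterior concentration).
Let `π` be a probability density on `ℝ^p`, continuous and positive at `θ*`, and let
`L T` be the sample-size-normalized prequential scores. Assume the quadratic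
representation (M1): `L T θ = L T (θ̂ T) + ½ (θ − θ̂ T)ᵀ H_T (θ − θ̂ T) + r_T(θ − θ̂ T)`
with `θ̂ T → θ*`, symmetric `H_T → H*` positive definite, and `|r_T(u)| ≤ c₀‖u‖³` for
`‖u‖ < ε₀` and large `T`; and the separation condition (M2). Then the generalized
posterior `π_T(θ) = π(θ) exp(−T·L_T(θ)) / z_T` concentrates at `θ*`:
`∫_{B_ε(θ*)} π_T(θ) dθ → 1` for every `ε > 0`. -/
theorem stmt_4 {p : ℕ} (θstar : EuclideanSpace ℝ (Fin p))
    (π : EuclideanSpace ℝ (Fin p) → ℝ)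
    (hπ_nonneg : ∀ θ, 0 ≤ π θ)
    (hπ_prob : ∫ θ, π θ = 1)
    (hπ_cont : ContinuousAt π θstar)
    (hπ_pos : 0 < π θstar)
    (L : ℕ → EuclideanSpace ℝ (Fin p) → ℝ)
    (hL_cont : ∀ T, Continuous (L T))
    -- (M1): quadratic representation with cubic remainder
    (θhat : ℕ → EuclideanSpace ℝ (Fin p))
    (hθhat : Tendsto θhat atTop (𝓝 θstar))
    (H : ℕ → Matrix (Fin p) (Fin p) ℝ) (Hstar : Matrix (Fin p) (Fin p) ℝ)
    (hH_symm : ∀ T, (H T).IsSymm)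
    (hH_lim : Tendsto H atTop (𝓝 Hstar))
    (hHstar_posdef : Hstar.PosDef)
    (r : ℕ → EuclideanSpace ℝ (Fin p) → ℝ)
    (hrep : ∀ T θ, L T θ = L T (θhat T)
      + (1 / 2) * (∑ i, ∑ j, (θ - θhat T) i * H T i j * (θ - θhat T) j)
      + r T (θ - θhat T))
    (hrem : ∃ ε₀ > (0 : ℝ), ∃ c₀ > (0 : ℝ), ∀ᶠ T in atTop,
      ∀ u : EuclideanSpace ℝ (Fin p), ‖u‖ < ε₀ → |r T u| ≤ c₀ * ‖u‖ ^ 3)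
    -- (M2): separation condition, liminf_T inf_{‖θ − θ̂_T‖ ≥ ε} (L_T(θ) − L_T(θ̂_T)) > 0
    (hsep : ∀ ε > (0 : ℝ), ∃ δ > (0 : ℝ), ∀ᶠ T in atTop,
      ∀ θ : EuclideanSpace ℝ (Fin p), ε ≤ ‖θ - θhat T‖ → δ ≤ L T θ - L T (θhat T)) :
    ∀ ε > (0 : ℝ),
      Tendsto
        (fun T : ℕ => ∫ θ in Metric.ball θstar ε,
          π θ * Real.exp (-(T * L T θ)) / (∫ θ', Real.exp (-(T * L T θ')) * π θ'))
        atTop (𝓝 1) := by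
  intro ε hε
  have hπ_int : Integrable π := by
    by_contra h
    rw [integral_undef h] at hπ_prob
    exact zero_ne_one hπ_prob
  obtain ⟨δ, hδ, hsepδ⟩ := hsep (ε / 2) (half_pos hε)
  obtain ⟨ε₀, hε₀, c₀, hc₀, hr⟩ := hrem
  -- uniform smallness of the score difference near `θstar`
  have hu : Tendsto (fun q : ℕ × EuclideanSpace ℝ (Fin p) => q.2 - θhat q.1)
      (atTop ×ˢ 𝓝 θstar) (𝓝 0) := by
    have := (tendsto_snd (f := (atTop : Filter ℕ)) (g := 𝓝 θstar)).sub
      (hθhat.comp (tendsto_fst (f := (atTop : Filter ℕ)) (g := 𝓝 θstar)))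
    simpa using this
  have hHM : Tendsto (fun q : ℕ × EuclideanSpace ℝ (Fin p) => H q.1)
      (atTop ×ˢ 𝓝 θstar) (𝓝 Hstar) := hH_lim.comp tendsto_fst
  have hF : Continuous (fun q : EuclideanSpace ℝ (Fin p) × Matrix (Fin p) (Fin p) ℝ =>
      (1 / 2) * (∑ i, ∑ j, q.1 i * q.2 i j * q.1 j) + c₀ * ‖q.1‖ ^ 3) := by
    fun_prop
  have hlim := (hF.tendsto (0, Hstar)).comp (hu.prodMk_nhds hHM)
  have hlim0 : ∀ᶠ q : ℕ × EuclideanSpace ℝ (Fin p) in atTop ×ˢ 𝓝 θstar,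
      (1 / 2) * (∑ i, ∑ j, (q.2 - θhat q.1) i * H q.1 i j * (q.2 - θhat q.1) j)
        + c₀ * ‖q.2 - θhat q.1‖ ^ 3 < δ / 2 := by
    apply hlim.eventually_lt_const
    simpa using half_pos hδ
  have hsmall : ∀ᶠ q : ℕ × EuclideanSpace ℝ (Fin p) in atTop ×ˢ 𝓝 θstar,
      L q.1 q.2 - L q.1 (θhat q.1) ≤ δ / 2 := by
    have hn : ∀ᶠ q : ℕ × EuclideanSpace ℝ (Fin p) in atTop ×ˢ 𝓝 θstar,
        ‖q.2 - θhat q.1‖ < ε₀ := by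
      apply hu.norm.eventually_lt_const
      simpa using hε₀
    filter_upwards [hlim0, hn, tendsto_fst.eventually hr] with q h1 h2 h3
    have h4 := (abs_le.1 (h3 _ h2)).2
    have h5 := hrep q.1 q.2
    linarith
  have hball : ∀ᶠ θ in 𝓝 θstar, π θstar / 2 ≤ π θ :=
    (hπ_cont.eventually (lt_mem_nhds (half_lt_self hπ_pos))).mono fun _ h => le_of_lt h
  obtain ⟨P, hP, Q, hQ, hPQ⟩ := eventually_prod_iff.1 hsmall
  obtain ⟨η, hη, hηb⟩ := Metric.eventually_nhds_iff_ball.1 (hQ.and hball)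
  set c : ℝ := π θstar / 2 * volume.real (Metric.ball θstar η) with hc
  have hcpos : 0 < c := by
    apply mul_pos (half_pos hπ_pos)
    exact ENNReal.toReal_pos (Metric.measure_ball_pos _ _ hη).ne' measure_ball_lt_top.ne
  have hto : Tendsto (fun T : ℕ => Real.exp (-(T * (δ / 2))) / c) atTop (𝓝 0) := by
    have h1 : Tendsto (fun T : ℕ => (T : ℝ) * (δ / 2)) atTop atTop :=
      tendsto_natCast_atTop_atTop.atTop_mul_const (half_pos hδ)
    have := (Real.tendsto_exp_neg_atTop_nhds_zero.comp h1).div_const c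
    simpa using this
  rw [tendsto_iff_norm_sub_tendsto_zero]
  refine squeeze_zero' (Eventually.of_forall fun _ => norm_nonneg _) ?_ hto
  have hnear : ∀ᶠ T in atTop, dist (θhat T) θstar < ε / 2 :=
    Metric.tendsto_nhds.1 hθhat _ (half_pos hε)
  filter_upwards [hsepδ, hP, hnear] with T hT1 hT2 hT3
  set g : EuclideanSpace ℝ (Fin p) → ℝ :=
    fun θ => Real.exp (-(T * (L T θ - L T (θhat T)))) with hg
  have hT0 : (0 : ℝ) ≤ T := Nat.cast_nonneg T
  have hgc : Continuous g := by
    have := hL_cont T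
    fun_prop
  have hgpos : ∀ θ, 0 < g θ := fun θ => Real.exp_pos _
  have hgint : Integrable (fun θ => g θ * π θ) := by
    obtain ⟨M, hM⟩ := (isCompact_closedBall (θhat T) (ε / 2)).exists_bound_of_continuousOn
      hgc.continuousOn
    refine hπ_int.bdd_mul (c := max M 1) hgc.aestronglyMeasurable (Eventually.of_forall ?_)
    intro θ
    by_cases h : θ ∈ Metric.closedBall (θhat T) (ε / 2)
    · exact (hM θ h).trans (le_max_left _ _)
    · refine le_trans ?_ (le_max_right _ _)
      have h' : ε / 2 ≤ ‖θ - θhat T‖ := by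
        rw [Metric.mem_closedBall, dist_eq_norm] at h
        exact (not_le.1 h).le
      rw [Real.norm_of_nonneg (hgpos θ).le]
      apply Real.exp_le_one_iff.2
      have := mul_nonneg hT0 (hδ.le.trans (hT1 θ h'))
      linarith
  have hgn : ∀ θ, 0 ≤ g θ * π θ := fun θ => mul_nonneg (hgpos θ).le (hπ_nonneg θ)
  set Z : ℝ := ∫ θ, g θ * π θ with hZ
  have hfac : ∀ θ, Real.exp (-(T * L T θ)) = Real.exp (-(T * L T (θhat T))) * g θ := by
    intro θ
    rw [hg, ← Real.exp_add]
    congr 1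
    ring
  have hz : ∫ θ', Real.exp (-(T * L T θ')) * π θ' = Real.exp (-(T * L T (θhat T))) * Z := by
    rw [hZ, ← integral_const_mul]
    congr 1
    ext θ
    rw [hfac θ]
    ring
  have hZlow : c * Real.exp (-(T * (δ / 2))) ≤ Z := by
    have h1 : ∫ θ in Metric.ball θstar η, (π θstar / 2 * Real.exp (-(T * (δ / 2)))) ≤
        ∫ θ in Metric.ball θstar η, g θ * π θ := by
      apply setIntegral_mono_on _ hgint.integrableOn measurableSet_ball
      · intro θ hθ
        obtain ⟨hq, hp⟩ := hηb θ hθ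
        have h2 := hPQ hT2 hq
        rw [mul_comm]
        apply mul_le_mul _ hp (half_pos hπ_pos).le (hgpos θ).le
        apply Real.exp_le_exp.2
        have := mul_le_mul_of_nonneg_left h2 hT0
        simp only at this
        linarith
      · exact integrableOn_const measure_ball_lt_top.ne
    have h2 : ∫ θ in Metric.ball θstar η, g θ * π θ ≤ Z :=
      setIntegral_le_integral hgint (Eventually.of_forall hgn)
    rw [setIntegral_const, smul_eq_mul] at h1
    calc _ = _ := by rw [hc]; ring
      _ ≤ _ := h1.trans h2
  have hZpos : 0 < Z := lt_of_lt_of_le (mul_pos hcpos (Real.exp_pos _)) hZlow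
  have hCup : ∫ θ in (Metric.ball θstar ε)ᶜ, g θ * π θ ≤ Real.exp (-(T * δ)) := by
    calc _ ≤ ∫ θ in (Metric.ball θstar ε)ᶜ, Real.exp (-(T * δ)) * π θ := by
          apply setIntegral_mono_on hgint.integrableOn
            (hπ_int.const_mul _).integrableOn measurableSet_ball.compl
          intro θ hθ
          have h' : ε / 2 ≤ ‖θ - θhat T‖ := by
            have h3 : ε ≤ dist θ θstar := by simpa using hθ
            have h4 := dist_triangle θ (θhat T) θstar
            rw [← dist_eq_norm]
            linarith
          apply mul_le_mul_of_nonneg_right _ (hπ_nonneg θ)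
          apply Real.exp_le_exp.2
          have := mul_le_mul_of_nonneg_left (hT1 θ h') hT0
          linarith
      _ ≤ ∫ θ, Real.exp (-(T * δ)) * π θ :=
          setIntegral_le_integral (hπ_int.const_mul _)
            (Eventually.of_forall fun θ => mul_nonneg (Real.exp_pos _).le (hπ_nonneg θ))
      _ = Real.exp (-(T * δ)) := by rw [integral_const_mul, hπ_prob, mul_one]
  have hCn : 0 ≤ ∫ θ in (Metric.ball θstar ε)ᶜ, g θ * π θ := integral_nonneg hgn
  have hsplit : (∫ θ in Metric.ball θstar ε, g θ * π θ)
      + ∫ θ in (Metric.ball θstar ε)ᶜ, g θ * π θ = Z :=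
    integral_add_compl measurableSet_ball hgint
  have hA : ∫ θ in Metric.ball θstar ε,
      π θ * Real.exp (-(T * L T θ)) / (∫ θ', Real.exp (-(T * L T θ')) * π θ')
      = (∫ θ in Metric.ball θstar ε, g θ * π θ) / Z := by
    rw [hz, ← integral_div]
    congr 1
    ext θ
    rw [hfac θ]
    have := Real.exp_pos (-(T * L T (θhat T)))
    field_simp
  rw [hA]
  have hdiff : (∫ θ in Metric.ball θstar ε, g θ * π θ) / Z - 1
      = -((∫ θ in (Metric.ball θstar ε)ᶜ, g θ * π θ) / Z) := by
    field_simp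
    linarith
  rw [hdiff, norm_neg, Real.norm_of_nonneg (div_nonneg hCn hZpos.le)]
  rw [div_le_div_iff₀ hZpos hcpos]
  have hee : Real.exp (-(T * δ)) = Real.exp (-(T * (δ / 2))) * Real.exp (-(T * (δ / 2))) := by
    rw [← Real.exp_add]
    congr 1
    ring
  calc _ ≤ Real.exp (-(T * δ)) * c := mul_le_mul_of_nonneg_right hCup hcpos.le
    _ = Real.exp (-(T * (δ / 2))) * (c * Real.exp (-(T * (δ / 2)))) := by rw [hee]; ring
    _ ≤ _ := mul_le_mul_of_nonneg_left hZlow (Real.exp_pos _).le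
end

section
/- Under the stated assumptions (prior conditions on π, the quadratic representation (M1), and the separation condition (M2)), the normalizing constant satisfies the Laplace approximation: z_T · |det H*|^{1/2} · exp(T·L_T(θ̂_T)) / ( π(θ*) · (2π/T)^{p/2} ) → 1 as T → ∞; equivalently z_T ∼ exp(−T·L_T(θ̂_T)) · π(θ*) · |det H*|^{−1/2} · (2π/T)^{p/2}. -/
open Filter Topology MeasureTheory

section aux
variable {p : ℕ}

lemma aux_factor (H : Matrix (Fin p) (Fin p) ℝ) (hH : H.PosDef) :
    ∃ f : (EuclideanSpace ℝ (Fin p)) →ₗ[ℝ] (EuclideanSpace ℝ (Fin p)), (∀ x : EuclideanSpace ℝ (Fin p), ∑ i, ∑ j, x i * H i j * x j = ‖f x‖ ^ 2) ∧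
      (LinearMap.det f) ^ 2 = H.det := by
  obtain ⟨B, hB⟩ : ∃ B : Matrix (Fin p) (Fin p) ℝ, H = B.transpose * B := by
    obtain ⟨B, hB⟩ := by
      open scoped MatrixOrder Matrix.Norms.L2Operator in
      exact CStarAlgebra.nonneg_iff_eq_star_mul_self.mp hH.posSemidef.nonneg
    refine ⟨B, ?_⟩
    rw [hB, Matrix.star_eq_conjTranspose, Matrix.conjTranspose_eq_transpose_of_trivial]
  refine ⟨Matrix.toLpLin 2 2 B, ?_, ?_⟩
  · intro x
    rw [EuclideanSpace.norm_sq_eq]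
    have h1 : ∀ k, (Matrix.toLpLin 2 2 B x) k = ∑ i, B k i * x i := by
      intro k
      simp [Matrix.toLpLin_apply, Matrix.mulVec, dotProduct]
    simp only [h1, Real.norm_eq_abs, sq_abs, hB, Matrix.mul_apply, Matrix.transpose_apply]
    simp only [sq, Finset.mul_sum, Finset.sum_mul]
    conv_lhs => enter [2, j]; rw [Finset.sum_comm]
    rw [Finset.sum_comm]
    refine Finset.sum_congr rfl fun k _ => Finset.sum_congr rfl fun i _ =>
      Finset.sum_congr rfl fun j _ => ?_
    ring
  · rw [LinearMap.det_toLpLin, hB, Matrix.det_mul, Matrix.det_transpose, sq]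

lemma aux_lower (f : (EuclideanSpace ℝ (Fin p)) →ₗ[ℝ] (EuclideanSpace ℝ (Fin p))) (hf : LinearMap.det f ≠ 0) :
    ∃ l > 0, ∀ x, l * ‖x‖ ^ 2 ≤ ‖f x‖ ^ 2 := by
  have hinj : LinearMap.ker f = ⊥ := by
    by_contra h
    exact hf (LinearMap.det_eq_zero_iff_ker_ne_bot.2 h)
  obtain ⟨K, hK, hA⟩ := LinearMap.exists_antilipschitzWith f hinj
  have hK' : (0 : ℝ) < K := by exact_mod_cast hK
  refine ⟨((K : ℝ) ^ 2)⁻¹, by positivity, fun x => ?_⟩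
  have h := hA.le_mul_dist x 0
  simp only [dist_zero_right, map_zero] at h
  rw [inv_mul_le_iff₀ (by positivity), ← mul_pow]
  gcongr

lemma aux_gauss (f : (EuclideanSpace ℝ (Fin p)) →ₗ[ℝ] (EuclideanSpace ℝ (Fin p))) (hf : LinearMap.det f ≠ 0) :
    ∫ x, Real.exp (-((1 / 2) * ‖f x‖ ^ 2)) =
      |LinearMap.det f|⁻¹ * (2 * Real.pi) ^ ((p : ℝ) / 2) := by
  have hfc : Continuous f := f.continuous_of_finiteDimensional
  have h1 := integral_map (μ := (volume : Measure (EuclideanSpace ℝ (Fin p)))) (φ := f)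
    (f := fun y => Real.exp (-(1 / 2) * ‖y‖ ^ 2)) hfc.aemeasurable
    (by fun_prop)
  rw [Measure.map_linearMap_addHaar_eq_smul_addHaar _ hf, integral_smul_measure,
    GaussianFourier.integral_rexp_neg_mul_sq_norm (by norm_num)] at h1
  simp only [neg_mul] at h1
  rw [← h1, ENNReal.toReal_ofReal (by positivity), abs_inv, smul_eq_mul]
  simp [mul_comm]

lemma aux_integrable (l : ℝ) (hl : 0 < l) :
    Integrable (fun x : EuclideanSpace ℝ (Fin p) => Real.exp (-l * ‖x‖ ^ 2)) := by
  by_contra h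
  have h1 := integral_undef h
  rw [GaussianFourier.integral_rexp_neg_mul_sq_norm hl] at h1
  have : 0 < (Real.pi / l) ^ ((Module.finrank ℝ (EuclideanSpace ℝ (Fin p)) : ℝ) / 2) := by positivity
  linarith

lemma aux_quad (A : Matrix (Fin p) (Fin p) ℝ) (x : EuclideanSpace ℝ (Fin p)) :
    |∑ i, ∑ j, x i * A i j * x j| ≤ (∑ i, ∑ j, |A i j|) * ‖x‖ ^ 2 := by
  refine (Finset.abs_sum_le_sum_abs _ _).trans ?_
  rw [Finset.sum_mul]
  refine Finset.sum_le_sum fun i _ => ?_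
  refine (Finset.abs_sum_le_sum_abs _ _).trans ?_
  rw [Finset.sum_mul]
  refine Finset.sum_le_sum fun j _ => ?_
  rw [abs_mul, abs_mul]
  have hi := PiLp.norm_apply_le x i
  have hj := PiLp.norm_apply_le x j
  rw [Real.norm_eq_abs] at hi hj
  calc |x i| * |A i j| * |x j| = |A i j| * (|x i| * |x j|) := by ring
    _ ≤ |A i j| * (‖x‖ * ‖x‖) := by gcongr
    _ = _ := by ring

lemma aux_scale (N : (EuclideanSpace ℝ (Fin p)) → ℝ) (a : EuclideanSpace ℝ (Fin p)) (s : ℝ) (hs : 0 < s) :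
    ∫ x, N (a + s⁻¹ • x) = s ^ p * ∫ x, N x := by
  have h := Measure.integral_comp_inv_smul_of_nonneg (volume : Measure (EuclideanSpace ℝ (Fin p)))
    (fun y => N (a + y)) hs.le
  rw [h, integral_add_left_eq_self N a]
  simp

lemma aux_scale_int (N : (EuclideanSpace ℝ (Fin p)) → ℝ) (hN : Integrable N) (a : EuclideanSpace ℝ (Fin p)) (s : ℝ) (hs : 0 < s) :
    Integrable (fun x => N (a + s⁻¹ • x)) :=
  (hN.comp_add_left a).comp_smul (inv_ne_zero hs.ne')

lemma aux_decay (p : ℕ) (d : ℝ) (hd : 0 < d) :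
    Tendsto (fun T : ℕ => (√(T : ℝ)) ^ p * Real.exp (-(T * d))) atTop (𝓝 0) := by
  have h1 : Tendsto (fun x : ℝ => x ^ ((p : ℝ) / 2) * Real.exp (-d * x)) atTop (𝓝 0) :=
    tendsto_rpow_mul_exp_neg_mul_atTop_nhds_zero _ _ hd
  refine (h1.comp tendsto_natCast_atTop_atTop).congr fun T => ?_
  simp only [Function.comp]
  congr 1
  · rw [Real.sqrt_eq_rpow, ← Real.rpow_natCast, ← Real.rpow_mul (by positivity)]
    congr 1; ring
  · congr 1; ring
end aux

/-- **Theorem 1, part (ii)** (Bernstein–von Mises: Laplace approximation).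
Under the prior conditions on `π`, the quadratic representation (M1) and the separation
condition (M2), the normalizing constant `z_T = ∫ exp(−T·L_T(θ)) π(θ) dθ` satisfies
`z_T ∼ exp(−T·L_T(θ̂_T)) · π(θ*) · |det H*|^{−1/2} · (2π/T)^{p/2}`, i.e. the ratio of the
two sides tends to `1`. -/
theorem stmt_5 {p : ℕ} (θstar : EuclideanSpace ℝ (Fin p))
    (π : EuclideanSpace ℝ (Fin p) → ℝ)
    (hπ_nonneg : ∀ θ, 0 ≤ π θ)
    (hπ_prob : ∫ θ, π θ = 1)
    (hπ_cont : ContinuousAt π θstar)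
    (hπ_pos : 0 < π θstar)
    (L : ℕ → EuclideanSpace ℝ (Fin p) → ℝ)
    (hL_cont : ∀ T, Continuous (L T))
    -- (M1): quadratic representation with cubic remainder
    (θhat : ℕ → EuclideanSpace ℝ (Fin p))
    (hθhat : Tendsto θhat atTop (𝓝 θstar))
    (H : ℕ → Matrix (Fin p) (Fin p) ℝ) (Hstar : Matrix (Fin p) (Fin p) ℝ)
    (hH_symm : ∀ T, (H T).IsSymm)
    (hH_lim : Tendsto H atTop (𝓝 Hstar))
    (hHstar_posdef : Hstar.PosDef)
    (r : ℕ → EuclideanSpace ℝ (Fin p) → ℝ)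
    (hrep : ∀ T θ, L T θ = L T (θhat T)
      + (1 / 2) * (∑ i, ∑ j, (θ - θhat T) i * H T i j * (θ - θhat T) j)
      + r T (θ - θhat T))
    (hrem : ∃ ε₀ > (0 : ℝ), ∃ c₀ > (0 : ℝ), ∀ᶠ T in atTop,
      ∀ u : EuclideanSpace ℝ (Fin p), ‖u‖ < ε₀ → |r T u| ≤ c₀ * ‖u‖ ^ 3)
    -- (M2): separation condition
    (hsep : ∀ ε > (0 : ℝ), ∃ δ > (0 : ℝ), ∀ᶠ T in atTop,
      ∀ θ : EuclideanSpace ℝ (Fin p), ε ≤ ‖θ - θhat T‖ → δ ≤ L T θ - L T (θhat T)) :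
    Tendsto
      (fun T : ℕ =>
        (∫ θ, Real.exp (-(T * L T θ)) * π θ)
          * |Hstar.det| ^ ((1 : ℝ) / 2) * Real.exp (T * L T (θhat T))
          / (π θstar * (2 * Real.pi / T) ^ ((p : ℝ) / 2)))
      atTop (𝓝 1) := by
  obtain ⟨f, hfq, hfdet⟩ := aux_factor Hstar hHstar_posdef
  have hdetpos : 0 < Hstar.det := hHstar_posdef.det_pos
  have hfne : LinearMap.det f ≠ 0 := by
    intro h; rw [h] at hfdet; simp at hfdet; linarith
  obtain ⟨l, hl, hlow⟩ := aux_lower f hfne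
  obtain ⟨ε₀, hε₀, c₀, hc₀, hr⟩ := hrem
  have hπint : Integrable π := by
    by_contra h
    rw [integral_undef h] at hπ_prob
    norm_num at hπ_prob
  -- local boundedness of the prior
  obtain ⟨ρ, hρ, hπb⟩ : ∃ ρ > 0, ∀ θ, dist θ θstar < ρ → π θ ≤ π θstar + 1 := by
    obtain ⟨ρ, hρ, h⟩ := Metric.continuousAt_iff.1 hπ_cont 1 one_pos
    refine ⟨ρ, hρ, fun θ hθ => ?_⟩
    have := h hθ
    rw [Real.dist_eq] at this
    linarith [(abs_lt.1 this).2]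
  obtain ⟨ε, hε, hεε₀, hερ, hεc⟩ : ∃ ε > 0, ε ≤ ε₀ ∧ ε ≤ ρ / 2 ∧ c₀ * ε ≤ l / 8 := by
    refine ⟨min ε₀ (min (ρ / 2) (l / 8 / c₀)), by positivity, min_le_left _ _,
      (min_le_right _ _).trans (min_le_left _ _), ?_⟩
    rw [mul_comm, ← le_div_iff₀ hc₀]
    exact (min_le_right _ _).trans (min_le_right _ _)
  obtain ⟨δ, hδ, hfar⟩ := hsep ε hε
  have hη : Tendsto (fun T => ∑ i, ∑ j, |(H T - Hstar) i j|) atTop (𝓝 0) := by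
    have h0 : (0 : ℝ) = ∑ i : Fin p, ∑ j : Fin p, |(Hstar - Hstar) i j| := by simp
    rw [h0]
    refine tendsto_finsetSum _ fun i _ => tendsto_finsetSum _ fun j _ => ?_
    have h1 : Tendsto (fun T => H T i j) atTop (𝓝 (Hstar i j)) :=
      tendsto_pi_nhds.1 (tendsto_pi_nhds.1 hH_lim i) j
    exact (h1.sub_const _).abs
  -- the local lower bound
  have hnear : ∀ᶠ T in atTop, ∀ θ, ‖θ - θhat T‖ < ε →
      l / 8 * ‖θ - θhat T‖ ^ 2 ≤ L T θ - L T (θhat T) := by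
    filter_upwards [hr, hη.eventually (gt_mem_nhds (half_pos hl))] with T hrT hηT θ hθ
    rw [hrep T θ]
    generalize θ - θhat T = u at hθ ⊢
    have h1 := hrT u (hθ.trans_le hεε₀)
    have h2 := aux_quad (H T - Hstar) u
    have h3 : ∑ i, ∑ j, u i * (H T - Hstar) i j * u j =
        (∑ i, ∑ j, u i * H T i j * u j) - ∑ i, ∑ j, u i * Hstar i j * u j := by
      simp only [← Finset.sum_sub_distrib, Matrix.sub_apply]
      exact Finset.sum_congr rfl fun i _ => Finset.sum_congr rfl fun j _ => by ring
    have h4 : (∑ i, ∑ j, |(H T - Hstar) i j|) * ‖u‖ ^ 2 ≤ l / 2 * ‖u‖ ^ 2 := by gcongr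
    have h5 := hlow u
    rw [← hfq] at h5
    have h6 : c₀ * ‖u‖ ^ 3 ≤ l / 8 * ‖u‖ ^ 2 := by
      calc c₀ * ‖u‖ ^ 3 = c₀ * ‖u‖ * ‖u‖ ^ 2 := by ring
        _ ≤ c₀ * ε * ‖u‖ ^ 2 := by gcongr
        _ ≤ _ := by gcongr
    have h7 := (abs_le.1 h1).1
    have h8 := (abs_le.1 h2).1
    linarith
  -- near and far parts
  set G : ℕ → EuclideanSpace ℝ (Fin p) → ℝ :=
    fun T θ => Real.exp (-(T * (L T θ - L T (θhat T)))) * π θ with hG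
  set B : ℕ → Set (EuclideanSpace ℝ (Fin p)) := fun T => Metric.ball (θhat T) ε with hB
  have hBm : ∀ T, MeasurableSet (B T) := fun T => measurableSet_ball
  have hGm : ∀ T, AEStronglyMeasurable (G T) := fun T => by
    have : Continuous fun θ => Real.exp (-(T * (L T θ - L T (θhat T)))) := by
      have := hL_cont T
      fun_prop
    exact this.aestronglyMeasurable.mul hπint.aestronglyMeasurable
  have hG0 : ∀ T θ, 0 ≤ G T θ := fun T θ => mul_nonneg (Real.exp_pos _).le (hπ_nonneg θ)
  have hGint : ∀ᶠ T in atTop, Integrable (G T) := by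
    filter_upwards [hnear, hfar] with T h1 h2
    refine hπint.mono (hGm T) (Eventually.of_forall fun θ => ?_)
    rw [Real.norm_of_nonneg (hG0 T θ), Real.norm_of_nonneg (hπ_nonneg θ)]
    refine mul_le_of_le_one_left (hπ_nonneg θ) (Real.exp_le_one_iff.2 ?_)
    have : 0 ≤ L T θ - L T (θhat T) := by
      rcases lt_or_ge ‖θ - θhat T‖ ε with h | h
      · exact le_trans (by positivity) (h1 θ h)
      · exact hδ.le.trans (h2 θ h)
    have : 0 ≤ (T : ℝ) * (L T θ - L T (θhat T)) := by positivity
    linarith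
  have hFar : Tendsto (fun T : ℕ => (√(T : ℝ)) ^ p * ∫ θ in (B T)ᶜ, G T θ) atTop (𝓝 0) := by
    refine tendsto_of_tendsto_of_tendsto_of_le_of_le' tendsto_const_nhds (aux_decay p δ hδ)
      (Eventually.of_forall fun T => ?_) ?_
    · exact mul_nonneg (by positivity) (integral_nonneg (hG0 T))
    · filter_upwards [hGint, hfar] with T hi h2
      gcongr
      calc ∫ θ in (B T)ᶜ, G T θ ≤ ∫ θ in (B T)ᶜ, Real.exp (-(T * δ)) * π θ := by
            refine setIntegral_mono_on hi.integrableOn (hπint.const_mul _).integrableOn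
              (hBm T).compl fun θ hθ => ?_
            have h3 : ε ≤ ‖θ - θhat T‖ := by
              rw [← dist_eq_norm]
              simpa [hB] using hθ
            have h4 := h2 θ h3
            simp only [hG]
            have := hπ_nonneg θ
            gcongr
        _ ≤ ∫ θ, Real.exp (-(T * δ)) * π θ := by
            refine setIntegral_le_integral (hπint.const_mul _) (Eventually.of_forall fun θ => ?_)
            exact mul_nonneg (Real.exp_pos _).le (hπ_nonneg θ)
        _ = _ := by rw [integral_const_mul, hπ_prob, mul_one]
  have hsq : Tendsto (fun T : ℕ => (√(T : ℝ))⁻¹) atTop (𝓝 0) :=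
    (Real.tendsto_sqrt_atTop.comp tendsto_natCast_atTop_atTop).inv_tendsto_atTop
  have hNear : Tendsto (fun T : ℕ => (√(T : ℝ)) ^ p * ∫ θ in B T, G T θ) atTop
      (𝓝 (∫ x, Real.exp (-((1 / 2) * ‖f x‖ ^ 2)) * π θstar)) := by
    have key : Tendsto (fun T : ℕ => ∫ x, (B T).indicator (G T) (θhat T + (√(T : ℝ))⁻¹ • x))
        atTop (𝓝 (∫ x, Real.exp (-((1 / 2) * ‖f x‖ ^ 2)) * π θstar)) := by
      refine tendsto_integral_filter_of_dominated_convergence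
        (fun x => Real.exp (-(l / 8) * ‖x‖ ^ 2) * (π θstar + 1)) ?_ ?_
        ((aux_integrable (l / 8) (by positivity)).mul_const _) ?_
      · filter_upwards [hGint, eventually_gt_atTop 0] with T hi hT
        have hs : 0 < √(T : ℝ) := Real.sqrt_pos.2 (by exact_mod_cast hT)
        exact (aux_scale_int _ (hi.indicator (hBm T)) _ _ hs).aestronglyMeasurable
      · filter_upwards [hnear, eventually_gt_atTop 0,
          hθhat.eventually (Metric.ball_mem_nhds θstar (half_pos hρ))] with T h1 hT h2
        refine Eventually.of_forall fun x => ?_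
        have hT' : (0 : ℝ) < T := by exact_mod_cast hT
        have hs : 0 < √(T : ℝ) := Real.sqrt_pos.2 hT'
        have hss : (√(T : ℝ)) ^ 2 = T := Real.sq_sqrt hT'.le
        rw [Real.norm_of_nonneg (Set.indicator_nonneg (fun θ _ => hG0 T θ) _)]
        by_cases hm : θhat T + (√(T : ℝ))⁻¹ • x ∈ B T
        · rw [Set.indicator_of_mem hm]
          have hm1 : dist (θhat T + (√(T : ℝ))⁻¹ • x) (θhat T) < ε := hm
          have hm2 := hm1
          rw [dist_eq_norm] at hm2
          have h3 := h1 _ hm2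
          rw [add_sub_cancel_left, norm_smul, norm_inv, Real.norm_of_nonneg hs.le] at h3
          have h4 : l / 8 * ‖x‖ ^ 2 ≤ T * (L T (θhat T + (√(T : ℝ))⁻¹ • x) - L T (θhat T)) := by
            calc l / 8 * ‖x‖ ^ 2 = T * (l / 8 * ((√(T : ℝ))⁻¹ * ‖x‖) ^ 2) := by
                  rw [mul_pow, inv_pow, hss]; field_simp
              _ ≤ _ := by gcongr
          simp only [hG]
          have h5 : π (θhat T + (√(T : ℝ))⁻¹ • x) ≤ π θstar + 1 := by
            apply hπb
            have h6 : dist (θhat T) θstar < ρ / 2 := h2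
            linarith [dist_triangle (θhat T + (√(T : ℝ))⁻¹ • x) (θhat T) θstar]
          have h7 : Real.exp (-(T * (L T (θhat T + (√(T : ℝ))⁻¹ • x) - L T (θhat T)))) ≤
              Real.exp (-(l / 8) * ‖x‖ ^ 2) := Real.exp_le_exp.2 (by linarith)
          exact mul_le_mul h7 h5 (hπ_nonneg _) (Real.exp_pos _).le
        · rw [Set.indicator_of_notMem hm]
          positivity
      · refine Eventually.of_forall fun x => ?_
        have hsx : Tendsto (fun T : ℕ => (√(T : ℝ))⁻¹ • x) atTop (𝓝 0) := by
          simpa using hsq.smul_const x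
        have hpt : Tendsto (fun T : ℕ => θhat T + (√(T : ℝ))⁻¹ • x) atTop (𝓝 θstar) := by
          simpa using hθhat.add hsx
        have hπlim := hπ_cont.tendsto.comp hpt
        have hsmall : ∀ e > 0, ∀ᶠ T : ℕ in atTop, ‖(√(T : ℝ))⁻¹ • x‖ < e := fun e he => by
          simpa using hsx.eventually (Metric.ball_mem_nhds 0 he)
        have hrlim : Tendsto (fun T : ℕ => T * r T ((√(T : ℝ))⁻¹ • x)) atTop (𝓝 0) := by
          have hb : Tendsto (fun T : ℕ => c₀ * ‖x‖ ^ 3 * (√(T : ℝ))⁻¹) atTop (𝓝 0) := by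
            simpa using hsq.const_mul (c₀ * ‖x‖ ^ 3)
          refine squeeze_zero_norm' ?_ hb
          filter_upwards [hr, hsmall ε₀ hε₀, eventually_gt_atTop 0] with T h1 h2 hT
          have hT' : (0 : ℝ) < T := by exact_mod_cast hT
          have hs : 0 < √(T : ℝ) := Real.sqrt_pos.2 hT'
          have hss : (√(T : ℝ)) ^ 2 = T := Real.sq_sqrt hT'.le
          have h3 := h1 _ h2
          rw [norm_smul, norm_inv, Real.norm_of_nonneg hs.le] at h3
          rw [norm_mul, Real.norm_of_nonneg hT'.le, Real.norm_eq_abs]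
          calc (T : ℝ) * |r T ((√(T : ℝ))⁻¹ • x)|
              ≤ (√(T : ℝ)) ^ 2 * (c₀ * ((√(T : ℝ))⁻¹ * ‖x‖) ^ 3) := by rw [hss]; gcongr
            _ = _ := by field_simp
        have hqlim : Tendsto (fun T : ℕ => ∑ i, ∑ j, x i * H T i j * x j) atTop
            (𝓝 (‖f x‖ ^ 2)) := by
          rw [← hfq]
          refine tendsto_finsetSum _ fun i _ => tendsto_finsetSum _ fun j _ => ?_
          have h1 : Tendsto (fun T => H T i j) atTop (𝓝 (Hstar i j)) :=
            tendsto_pi_nhds.1 (tendsto_pi_nhds.1 hH_lim i) j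
          exact (h1.const_mul _).mul_const _
        have hlim := ((Real.continuous_exp.tendsto _).comp
          ((hqlim.const_mul (1 / 2)).add hrlim).neg).mul hπlim
        rw [add_zero] at hlim
        refine hlim.congr' ?_
        filter_upwards [hsmall ε hε, eventually_gt_atTop 0] with T h2 hT
        have hT' : (0 : ℝ) < T := by exact_mod_cast hT
        have hs : 0 < √(T : ℝ) := Real.sqrt_pos.2 hT'
        have hss : (√(T : ℝ)) ^ 2 = T := Real.sq_sqrt hT'.le
        have hm : θhat T + (√(T : ℝ))⁻¹ • x ∈ B T := by
          simp only [hB, Metric.mem_ball, dist_eq_norm, add_sub_cancel_left]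
          exact h2
        rw [Set.indicator_of_mem hm]
        simp only [hG, Function.comp]
        congr 3
        rw [hrep T (θhat T + (√(T : ℝ))⁻¹ • x), add_sub_cancel_left]
        have h3 : (T : ℝ) * ∑ i, ∑ j, ((√(T : ℝ))⁻¹ • x) i * H T i j * ((√(T : ℝ))⁻¹ • x) j =
            ∑ i, ∑ j, x i * H T i j * x j := by
          rw [Finset.mul_sum]
          refine Finset.sum_congr rfl fun i _ => ?_
          rw [Finset.mul_sum]
          refine Finset.sum_congr rfl fun j _ => ?_
          simp only [PiLp.smul_apply, smul_eq_mul]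
          calc (T : ℝ) * ((√(T : ℝ))⁻¹ * x i * H T i j * ((√(T : ℝ))⁻¹ * x j))
              = T * ((√(T : ℝ)) ^ 2)⁻¹ * (x i * H T i j * x j) := by rw [← inv_pow]; ring
            _ = _ := by rw [hss, mul_inv_cancel₀ hT'.ne', one_mul]
        rw [← h3]
        ring
    refine key.congr' ?_
    filter_upwards [eventually_gt_atTop 0] with T hT
    have hs : 0 < √(T : ℝ) := Real.sqrt_pos.2 (by exact_mod_cast hT)
    rw [aux_scale _ _ _ hs, integral_indicator (hBm T)]
  rw [integral_mul_const, aux_gauss f hfne] at hNear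
  have hdet : |Hstar.det| ^ ((1 : ℝ) / 2) = |LinearMap.det f| := by
    rw [← hfdet, ← Real.sqrt_eq_rpow, abs_of_nonneg (sq_nonneg _), Real.sqrt_sq_eq_abs]
  have hdf : 0 < |LinearMap.det f| := abs_pos.2 hfne
  have hpp : 0 < (2 * Real.pi) ^ ((p : ℝ) / 2) := by positivity
  have hfin := (hNear.add hFar).mul_const
    (|LinearMap.det f| / (π θstar * (2 * Real.pi) ^ ((p : ℝ) / 2)))
  have hone : (|LinearMap.det f|⁻¹ * (2 * Real.pi) ^ ((p : ℝ) / 2) * π θstar + 0) *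
      (|LinearMap.det f| / (π θstar * (2 * Real.pi) ^ ((p : ℝ) / 2))) = 1 := by
    field_simp
    ring
  rw [hone] at hfin
  refine hfin.congr' ?_
  filter_upwards [hGint, eventually_gt_atTop 0] with T hi hT
  have hT' : (0 : ℝ) < T := by exact_mod_cast hT
  have hs : 0 < √(T : ℝ) := Real.sqrt_pos.2 hT'
  rw [← mul_add, integral_add_compl (hBm T) hi, hdet]
  have hz : (∫ θ, Real.exp (-(T * L T θ)) * π θ) * Real.exp (T * L T (θhat T)) = ∫ θ, G T θ := by
    rw [← integral_mul_const]
    refine integral_congr_ae (Eventually.of_forall fun θ => ?_)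
    simp only [hG]
    rw [mul_right_comm, ← Real.exp_add]
    congr 2
    ring
  have hTp : (T : ℝ) ^ ((p : ℝ) / 2) = (√(T : ℝ)) ^ p := by
    rw [Real.sqrt_eq_rpow, ← Real.rpow_natCast, ← Real.rpow_mul (by positivity)]
    congr 1; ring
  rw [mul_right_comm (∫ θ, Real.exp (-(T * L T θ)) * π θ), hz, Real.div_rpow (by positivity) hT'.le, hTp]
  field_simp
end

section
/- Under the stated assumptions (prior conditions on π, the quadratic representation (M1), and the separation condition (M2)), let q_T be the density of √T·(θ − θ̂_T) when θ has density π_T, i.e., q_T(u) = T^{−p/2} · π_T(θ̂_T + u/√T). Then ∫_{ℝ^p} | q_T(u) − 𝒩(u | 0, (H*)^{−1}) | du → 0 as T → ∞, where 𝒩(· | 0, (H*)^{−1}) denotes the density of the p-dimensional Gaussian distribution with mean zero and covariance matrix (H*)^{−1}; that is, the law of the rescaled posterior converges to 𝒩(0, (H*)^{−1}) in total variation. -/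
open Filter Topology MeasureTheory

namespace BvM
abbrev EE (p : ℕ) := EuclideanSpace ℝ (Fin p)

/-- the quadratic form of a matrix -/
noncomputable def Q {p : ℕ} (M : Matrix (Fin p) (Fin p) ℝ) (u : EE p) : ℝ :=
  ∑ i, ∑ j, u i * M i j * u j

lemma Q_smul {p : ℕ} (M : Matrix (Fin p) (Fin p) ℝ) (a : ℝ) (u : EE p) :
    Q M (a • u) = a ^ 2 * Q M u := by
  simp only [Q, Finset.mul_sum, PiLp.smul_apply, smul_eq_mul]
  refine Finset.sum_congr rfl fun i _ => Finset.sum_congr rfl fun j _ => by ring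

lemma Q_cont {p : ℕ} (M : Matrix (Fin p) (Fin p) ℝ) : Continuous (Q M) := by
  unfold Q; fun_prop

lemma Q_diff {p : ℕ} (M N : Matrix (Fin p) (Fin p) ℝ) (u : EE p) :
    |Q M u - Q N u| ≤ (∑ i, ∑ j, |M i j - N i j|) * ‖u‖ ^ 2 := by
  simp only [Q, ← Finset.sum_sub_distrib, Finset.sum_mul]
  refine (Finset.abs_sum_le_sum_abs _ _).trans (Finset.sum_le_sum fun i _ => ?_)
  refine (Finset.abs_sum_le_sum_abs _ _).trans (Finset.sum_le_sum fun j _ => ?_)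
  have h1 : |u i| ≤ ‖u‖ := PiLp.norm_apply_le u i
  have h2 : |u j| ≤ ‖u‖ := PiLp.norm_apply_le u j
  have : u i * M i j * u j - u i * N i j * u j = (M i j - N i j) * (u i * u j) := by ring
  rw [this, abs_mul, abs_mul, pow_two]
  gcongr

lemma exists_factor {p : ℕ} {M : Matrix (Fin p) (Fin p) ℝ} (hM : M.PosDef) :
    ∃ B : Matrix (Fin p) (Fin p) ℝ, IsUnit B ∧ M = star B * B := by
  open scoped MatrixOrder Matrix.Norms.L2Operator in
  exact CStarAlgebra.isStrictlyPositive_iff_eq_star_mul_self.mp hM.isStrictlyPositive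

lemma Q_factor {p : ℕ} (B : Matrix (Fin p) (Fin p) ℝ) (u : EE p) :
    Q (star B * B) u = ‖Matrix.toEuclideanLin B u‖ ^ 2 := by
  rw [EuclideanSpace.norm_sq_eq]
  simp only [Real.norm_eq_abs, sq_abs]
  simp only [Q, Matrix.mul_apply, Matrix.toLpLin_apply, Matrix.mulVec, dotProduct,
    Matrix.star_apply, star_trivial, pow_two,
    Finset.mul_sum, Finset.sum_mul]
  rw [Finset.sum_comm_cycle]
  refine Finset.sum_congr rfl fun i _ => ?_
  rw [Finset.sum_comm]
  refine Finset.sum_congr rfl fun j _ => Finset.sum_congr rfl fun k _ => by ring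

lemma Q_coercive {p : ℕ} {M : Matrix (Fin p) (Fin p) ℝ} (hM : M.PosDef) :
    ∃ l > (0 : ℝ), ∀ u : EE p, l * ‖u‖ ^ 2 ≤ Q M u := by
  obtain ⟨B, hB, rfl⟩ := exists_factor hM
  have hinv : B⁻¹ * B = 1 := Matrix.nonsing_inv_mul _ ((Matrix.isUnit_iff_isUnit_det _).1 hB)
  let A : EE p →L[ℝ] EE p := LinearMap.toContinuousLinearMap (Matrix.toEuclideanLin B⁻¹)
  have key : ∀ u : EE p, ‖u‖ ≤ (‖A‖ + 1) * ‖Matrix.toEuclideanLin B u‖ := by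
    intro u
    have h : A (Matrix.toEuclideanLin B u) = u := by
      simp [A, Matrix.toLpLin_apply, hinv]
    calc ‖u‖ = ‖A (Matrix.toEuclideanLin B u)‖ := by rw [h]
      _ ≤ ‖A‖ * ‖Matrix.toEuclideanLin B u‖ := A.le_opNorm _
      _ ≤ _ := by gcongr; linarith
  refine ⟨((‖A‖ + 1) ^ 2)⁻¹, by positivity, fun u => ?_⟩
  rw [Q_factor, inv_mul_le_iff₀ (by positivity), ← mul_pow]
  gcongr
  exact key u

lemma integrable_gauss {p : ℕ} {b : ℝ} (hb : 0 < b) :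
    Integrable (fun v : EE p => Real.exp (-b * ‖v‖ ^ 2)) := by
  have := (GaussianFourier.integrable_cexp_neg_mul_sq_norm_add (V := EE p) (b := (b:ℂ))
    (by simpa using hb) 0 0).norm
  refine this.congr (ae_of_all _ fun v => ?_)
  simp only [Complex.norm_exp]
  congr 1
  simp [← Complex.ofReal_pow]

lemma integral_gauss {p : ℕ} {M : Matrix (Fin p) (Fin p) ℝ} (hM : M.PosDef) :
    Real.sqrt (M.det / (2 * Real.pi) ^ p) * ∫ u : EE p, Real.exp (-(1 / 2) * Q M u) = 1 := by
  obtain ⟨B, hB, rfl⟩ := exists_factor hM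
  have hd : B.det ≠ 0 := ((Matrix.isUnit_iff_isUnit_det _).1 hB).ne_zero
  have hd' : LinearMap.det (Matrix.toEuclideanLin B) ≠ 0 := by
    rwa [LinearMap.det_toLpLin]
  have h1 := Measure.map_linearMap_addHaar_eq_smul_addHaar (volume : Measure (EE p)) hd'
  have h2 : ∫ u : EE p, Real.exp (-(1 / 2) * Q (star B * B) u)
      = |B.det|⁻¹ * (2 * Real.pi) ^ ((p : ℝ) / 2) := by
    have h3 : ∫ u, Real.exp (-(1 / 2) * ‖u‖ ^ 2) ∂(Measure.map (Matrix.toEuclideanLin B)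
      (volume : Measure (EE p))) = ∫ u : EE p, Real.exp (-(1 / 2) * Q (star B * B) u) := by
      rw [integral_map (LinearMap.continuous_of_finiteDimensional _).aemeasurable
        (by fun_prop)]
      simp only [Q_factor]
    rw [← h3, h1, integral_smul_measure, 
      GaussianFourier.integral_rexp_neg_mul_sq_norm (by norm_num), LinearMap.det_toLpLin,
      ENNReal.toReal_ofReal (abs_nonneg _), abs_inv, smul_eq_mul, finrank_euclideanSpace_fin]
    congr 2
    ring
  rw [h2, Matrix.det_mul, Matrix.star_eq_conjTranspose, Matrix.det_conjTranspose, star_trivial,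
    Real.sqrt_div (mul_self_nonneg _), Real.sqrt_mul_self_eq_abs, 
    Real.sqrt_eq_rpow, ← Real.rpow_natCast, ← Real.rpow_mul (by positivity)]
  have : (p : ℝ) * (1 / 2) = p / 2 := by ring
  rw [this]
  have := abs_pos.2 hd
  have : 0 < (2 * Real.pi) ^ ((p : ℝ) / 2) := by positivity
  field_simp

lemma core_near {p : ℕ} {θstar : EE p} {π : EE p → ℝ}
    (hπ_nonneg : ∀ θ, 0 ≤ π θ) (hπ_cont : ContinuousAt π θstar)
    {D : ℕ → EE p → ℝ} {θhat : ℕ → EE p}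
    (hθhat : Tendsto θhat atTop (𝓝 θstar))
    {H : ℕ → Matrix (Fin p) (Fin p) ℝ} {Hstar : Matrix (Fin p) (Fin p) ℝ}
    (hH_lim : Tendsto H atTop (𝓝 Hstar)) (hHstar : Hstar.PosDef)
    {r : ℕ → EE p → ℝ}
    (hrep : ∀ T v, D T v = (1 / 2) * Q (H T) v + r T v)
    (hrem : ∃ ε₀ > (0 : ℝ), ∃ c₀ > (0 : ℝ), ∀ᶠ T in atTop,
      ∀ u : EE p, ‖u‖ < ε₀ → |r T u| ≤ c₀ * ‖u‖ ^ 3) :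
    ∃ ε > (0 : ℝ), ∃ l > (0 : ℝ), ∃ K : ℝ, 0 ≤ K ∧
      (∀ u, Real.exp (-(1 / 2) * Q Hstar u) ≤ Real.exp (-l * ‖u‖ ^ 2)) ∧
      (∀ᶠ T : ℕ in atTop, ∀ u : EE p, ‖(Real.sqrt T)⁻¹ • u‖ < ε →
        π (θhat T + (Real.sqrt T)⁻¹ • u) * Real.exp (-(T * D T ((Real.sqrt T)⁻¹ • u)))
          ≤ K * Real.exp (-l * ‖u‖ ^ 2)) ∧
      (∀ u, Tendsto (fun T : ℕ => π (θhat T + (Real.sqrt T)⁻¹ • u) *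
        Real.exp (-(T * D T ((Real.sqrt T)⁻¹ • u)))) atTop
        (𝓝 (π θstar * Real.exp (-(1 / 2) * Q Hstar u)))) := by
  obtain ⟨l, hl, hlQ⟩ := Q_coercive hHstar
  obtain ⟨ε₀, hε₀, c₀, hc₀, hr⟩ := hrem
  have hπ1 : ∀ᶠ x in 𝓝 θstar, π x < π θstar + 1 := hπ_cont.eventually_lt_const (by linarith)
  obtain ⟨η, hη, hπη⟩ := Metric.eventually_nhds_iff.1 hπ1
  have hHd : Tendsto (fun T => ∑ i, ∑ j, |H T i j - Hstar i j|) atTop (𝓝 0) := by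
    have : Tendsto (fun T => ∑ i, ∑ j, |H T i j - Hstar i j|) atTop
        (𝓝 (∑ i, ∑ j, |Hstar i j - Hstar i j|)) := by
      refine tendsto_finsetSum _ fun i _ => tendsto_finsetSum _ fun j _ => ?_
      have hij : Tendsto (fun T => H T i j) atTop (𝓝 (Hstar i j)) :=
        ((continuous_id.matrix_elem i j).tendsto Hstar).comp hH_lim
      exact (hij.sub_const _).abs
    simpa using this
  have hsq : Tendsto (fun T : ℕ => (Real.sqrt T)⁻¹) atTop (𝓝 0) :=
    tendsto_inv_atTop_zero.comp (Real.tendsto_sqrt_atTop.comp tendsto_natCast_atTop_atTop)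
  have hscale : ∀ T : ℕ, 1 ≤ T → ∀ u : EE p,
      T * D T ((Real.sqrt T)⁻¹ • u) = (1 / 2) * Q (H T) u + T * r T ((Real.sqrt T)⁻¹ • u) := by
    intro T hT u
    have hT' : (0 : ℝ) < T := by exact_mod_cast hT
    rw [hrep, Q_smul, inv_pow, Real.sq_sqrt hT'.le]
    field_simp
  have hT3 : ∀ T : ℕ, 1 ≤ T → ∀ u : EE p,
      T * (c₀ * ‖(Real.sqrt T)⁻¹ • u‖ ^ 3) = c₀ * ‖(Real.sqrt T)⁻¹ • u‖ * ‖u‖ ^ 2 := by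
    intro T hT u
    have hT' : (0 : ℝ) < T := by exact_mod_cast hT
    have h1 : ‖(Real.sqrt T)⁻¹ • u‖ ^ 2 = (T : ℝ)⁻¹ * ‖u‖ ^ 2 := by
      rw [norm_smul, mul_pow, Real.norm_eq_abs, sq_abs, inv_pow, Real.sq_sqrt hT'.le]
    rw [pow_succ, h1]
    field_simp
  refine ⟨min ε₀ (min (η / 2) (l / (8 * c₀))), by positivity, l / 8, by positivity,
    π θstar + 1, by linarith [hπ_nonneg θstar], ?_, ?_, ?_⟩
  · intro u
    apply Real.exp_le_exp.2
    nlinarith [hlQ u, sq_nonneg ‖u‖, mul_nonneg hl.le (sq_nonneg ‖u‖)]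
  · filter_upwards [hr, eventually_ge_atTop 1, hHd.eventually_lt_const (show 0 < l / 2 by positivity),
      Metric.tendsto_nhds.1 hθhat (η / 2) (by positivity)] with T hrT hT hHT hθT u hu
    simp only [lt_min_iff] at hu
    obtain ⟨hu1, hu2, hu3⟩ := hu
    have hT' : (0 : ℝ) < T := by exact_mod_cast hT
    have hp : π (θhat T + (Real.sqrt T)⁻¹ • u) ≤ π θstar + 1 := by
      refine (hπη ?_).le
      calc dist (θhat T + (Real.sqrt T)⁻¹ • u) θstar
          ≤ dist (θhat T + (Real.sqrt T)⁻¹ • u) (θhat T) + dist (θhat T) θstar :=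
            dist_triangle _ _ _
        _ < η := by rw [dist_self_add_left]; linarith
    refine mul_le_mul hp (Real.exp_le_exp.2 ?_) (Real.exp_pos _).le
      (by linarith [hπ_nonneg θstar])
    rw [hscale T hT]
    have h1 := Q_diff (H T) Hstar u
    have h2 : (∑ i, ∑ j, |H T i j - Hstar i j|) * ‖u‖ ^ 2 ≤ l / 2 * ‖u‖ ^ 2 := by gcongr
    have h3 : T * |r T ((Real.sqrt T)⁻¹ • u)| ≤ l / 8 * ‖u‖ ^ 2 := by
      calc T * |r T ((Real.sqrt T)⁻¹ • u)| ≤ T * (c₀ * ‖(Real.sqrt T)⁻¹ • u‖ ^ 3) := by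
            gcongr; exact hrT _ hu1
        _ = c₀ * ‖(Real.sqrt T)⁻¹ • u‖ * ‖u‖ ^ 2 := hT3 T hT u
        _ ≤ c₀ * (l / (8 * c₀)) * ‖u‖ ^ 2 := by gcongr
        _ = _ := by field_simp
    have h4 : -(T * r T ((Real.sqrt T)⁻¹ • u)) ≤ T * |r T ((Real.sqrt T)⁻¹ • u)| := by
      rw [← mul_neg]; gcongr; exact neg_le_abs _
    have h5 := (abs_le.1 h1).1
    have h6 := hlQ u
    nlinarith
  · intro u
    have hv : Tendsto (fun T : ℕ => (Real.sqrt T)⁻¹ • u) atTop (𝓝 0) := by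
      simpa using hsq.smul_const u
    refine Tendsto.mul ?_ ?_
    · refine hπ_cont.tendsto.comp ?_
      simpa using hθhat.add hv
    · refine (Real.continuous_exp.tendsto _).comp ?_
      have hQ : Tendsto (fun T => Q (H T) u) atTop (𝓝 (Q Hstar u)) := by
        rw [tendsto_iff_dist_tendsto_zero]
        refine squeeze_zero (fun _ => dist_nonneg) (fun T => Q_diff (H T) Hstar u) ?_
        simpa using hHd.mul_const (‖u‖ ^ 2)
      have hR : Tendsto (fun T : ℕ => T * r T ((Real.sqrt T)⁻¹ • u)) atTop (𝓝 0) := by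
        refine squeeze_zero_norm' (a := fun T : ℕ => c₀ * ‖(Real.sqrt T)⁻¹ • u‖ * ‖u‖ ^ 2) ?_ ?_
        · filter_upwards [hr, eventually_ge_atTop 1,
            hv.norm.eventually_lt_const (show ‖(0 : EE p)‖ < ε₀ by simpa using hε₀)]
            with T hrT hT hvT
          rw [← hT3 T hT, Real.norm_eq_abs, abs_mul, Nat.abs_cast]
          gcongr
          exact hrT _ hvT
        · simpa using (hv.norm.const_mul c₀).mul_const (‖u‖ ^ 2)
      have := ((hQ.const_mul (1 / 2)).add hR).neg
      have e : -(1 / 2 * Q Hstar u + 0) = -(1 / 2) * Q Hstar u := by ring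
      rw [e] at this
      refine this.congr' ?_
      filter_upwards [eventually_ge_atTop 1] with T hT
      rw [hscale T hT]

lemma core {p : ℕ} {θstar : EE p} {π : EE p → ℝ}
    (hπ_nonneg : ∀ θ, 0 ≤ π θ) (hπ_prob : ∫ θ, π θ = 1) (hπ_cont : ContinuousAt π θstar)
    {D : ℕ → EE p → ℝ} (hD : ∀ T, Continuous (D T)) {θhat : ℕ → EE p}
    (hθhat : Tendsto θhat atTop (𝓝 θstar))
    {H : ℕ → Matrix (Fin p) (Fin p) ℝ} {Hstar : Matrix (Fin p) (Fin p) ℝ}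
    (hH_lim : Tendsto H atTop (𝓝 Hstar)) (hHstar : Hstar.PosDef)
    {r : ℕ → EE p → ℝ}
    (hrep : ∀ T v, D T v = (1 / 2) * Q (H T) v + r T v)
    (hrem : ∃ ε₀ > (0 : ℝ), ∃ c₀ > (0 : ℝ), ∀ᶠ T in atTop,
      ∀ u : EE p, ‖u‖ < ε₀ → |r T u| ≤ c₀ * ‖u‖ ^ 3)
    (hsep : ∀ ε > (0 : ℝ), ∃ δ > (0 : ℝ), ∀ᶠ T in atTop,
      ∀ v : EE p, ε ≤ ‖v‖ → δ ≤ D T v) :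
    Integrable (fun u : EE p => Real.exp (-(1 / 2) * Q Hstar u)) ∧
    (∀ᶠ T : ℕ in atTop, Integrable (fun u => π (θhat T + (Real.sqrt T)⁻¹ • u) *
        Real.exp (-(T * D T ((Real.sqrt T)⁻¹ • u))))) ∧
    Tendsto (fun T : ℕ => ∫ u, |π (θhat T + (Real.sqrt T)⁻¹ • u) *
        Real.exp (-(T * D T ((Real.sqrt T)⁻¹ • u)))
        - π θstar * Real.exp (-(1 / 2) * Q Hstar u)|) atTop (𝓝 0) := by
  obtain ⟨ε, hε, l, hl, K, hK, hG, hbd, hlim⟩ :=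
    core_near hπ_nonneg hπ_cont hθhat hH_lim hHstar hrep hrem
  obtain ⟨δ, hδ, hfar⟩ := hsep ε hε
  have hπ_int : Integrable π := by
    by_contra h
    rw [integral_undef h] at hπ_prob
    exact zero_ne_one hπ_prob
  have hgi := integrable_gauss (p := p) hl
  have hGi : Integrable (fun u : EE p => Real.exp (-(1 / 2) * Q Hstar u)) := by
    refine hgi.mono' ?_ (ae_of_all _ fun u => ?_)
    · exact (Real.continuous_exp.comp ((Q_cont Hstar).const_mul _)).aestronglyMeasurable
    · rw [Real.norm_eq_abs, abs_of_pos (Real.exp_pos _)]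
      exact hG u
  set g : ℕ → EE p → ℝ := fun T u => π (θhat T + (Real.sqrt T)⁻¹ • u) *
        Real.exp (-(T * D T ((Real.sqrt T)⁻¹ • u))) with hg
  have hg0 : ∀ T u, 0 ≤ g T u := fun T u => mul_nonneg (hπ_nonneg _) (Real.exp_pos _).le
  let S : ℕ → Set (EE p) := fun T => {u | ‖(Real.sqrt T)⁻¹ • u‖ < ε}
  have hS : ∀ T, MeasurableSet (S T) := fun T =>
    (isOpen_lt (by fun_prop) continuous_const).measurableSet
  have hsq : Tendsto (fun T : ℕ => (Real.sqrt T)⁻¹) atTop (𝓝 0) :=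
    tendsto_inv_atTop_zero.comp (Real.tendsto_sqrt_atTop.comp tendsto_natCast_atTop_atTop)
  have hP : ∀ T : ℕ, 1 ≤ T → Integrable (fun u => π (θhat T + (Real.sqrt T)⁻¹ • u)) := by
    intro T hT
    have hT' : (0 : ℝ) < T := by exact_mod_cast hT
    exact (hπ_int.comp_add_left (θhat T)).comp_smul (inv_ne_zero (Real.sqrt_pos.2 hT').ne')
  have hPint : ∀ T : ℕ, 1 ≤ T → ∫ u, π (θhat T + (Real.sqrt T)⁻¹ • u) = (T : ℝ) ^ ((p : ℝ) / 2) := by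
    intro T hT
    rw [Measure.integral_comp_inv_smul volume (fun v => π (θhat T + v)),
      integral_add_left_eq_self π, hπ_prob, finrank_euclideanSpace_fin, smul_eq_mul, mul_one,
      abs_of_nonneg (by positivity), Real.sqrt_eq_rpow, ← Real.rpow_natCast,
      ← Real.rpow_mul (by positivity)]
    congr 1
    ring
  have hgm : ∀ T : ℕ, 1 ≤ T → AEStronglyMeasurable (g T) := by
    intro T hT
    refine (hP T hT).aestronglyMeasurable.mul (Continuous.aestronglyMeasurable ?_)
    have := hD T
    fun_prop
  have hAb : ∀ᶠ T : ℕ in atTop, ∀ u, (S T).indicator (g T) u ≤ K * Real.exp (-l * ‖u‖ ^ 2) := by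
    filter_upwards [hbd] with T h u
    by_cases hu : u ∈ S T
    · rw [Set.indicator_of_mem hu]; exact h u hu
    · rw [Set.indicator_of_notMem hu]; positivity
  have hA0 : ∀ T u, 0 ≤ (S T).indicator (g T) u := fun T u =>
    Set.indicator_nonneg (fun _ _ => hg0 _ _) _
  have hB0 : ∀ T u, 0 ≤ (S T)ᶜ.indicator (g T) u := fun T u =>
    Set.indicator_nonneg (fun _ _ => hg0 _ _) _
  have hBb : ∀ᶠ T : ℕ in atTop, ∀ u, (S T)ᶜ.indicator (g T) u ≤
      Real.exp (-δ * T) * π (θhat T + (Real.sqrt T)⁻¹ • u) := by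
    filter_upwards [hfar] with T h u
    by_cases hu : u ∈ S T
    · rw [Set.indicator_of_notMem (by simpa using hu)]
      exact mul_nonneg (Real.exp_pos _).le (hπ_nonneg _)
    · rw [Set.indicator_of_mem (by simpa using hu), mul_comm]
      refine mul_le_mul_of_nonneg_left (Real.exp_le_exp.2 ?_) (hπ_nonneg _)
      have := h ((Real.sqrt T)⁻¹ • u) (by simpa [S] using hu)
      have : (T : ℝ) * δ ≤ T * D T ((Real.sqrt T)⁻¹ • u) := by gcongr
      linarith
  have hAi : ∀ᶠ T : ℕ in atTop, Integrable ((S T).indicator (g T)) := by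
    filter_upwards [hAb, eventually_ge_atTop 1] with T h hT
    refine (hgi.const_mul K).mono' ((hgm T hT).indicator (hS T)) (ae_of_all _ fun u => ?_)
    rw [Real.norm_eq_abs, abs_of_nonneg (hA0 T u)]
    exact h u
  have hBi : ∀ᶠ T : ℕ in atTop, Integrable ((S T)ᶜ.indicator (g T)) := by
    filter_upwards [hBb, eventually_ge_atTop 1] with T h hT
    refine ((hP T hT).const_mul (Real.exp (-δ * T))).mono' ((hgm T hT).indicator (hS T).compl)
      (ae_of_all _ fun u => ?_)
    rw [Real.norm_eq_abs, abs_of_nonneg (hB0 T u)]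
    exact h u
  have hdec : ∀ T u, g T u = (S T).indicator (g T) u + (S T)ᶜ.indicator (g T) u := fun T u =>
    (Set.indicator_self_add_compl_apply (S T) (g T) u).symm
  have hBlim : Tendsto (fun T : ℕ => ∫ u, (S T)ᶜ.indicator (g T) u) atTop (𝓝 0) := by
    have h1 : Tendsto (fun T : ℕ => (T : ℝ) ^ ((p : ℝ) / 2) * Real.exp (-δ * T)) atTop (𝓝 0) :=
      (tendsto_rpow_mul_exp_neg_mul_atTop_nhds_zero _ δ hδ).comp tendsto_natCast_atTop_atTop
    refine squeeze_zero' (Eventually.of_forall fun T => integral_nonneg (hB0 T)) ?_ h1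
    filter_upwards [hBb, hBi, eventually_ge_atTop 1] with T h hi hT
    calc ∫ u, (S T)ᶜ.indicator (g T) u
        ≤ ∫ u, Real.exp (-δ * T) * π (θhat T + (Real.sqrt T)⁻¹ • u) :=
          integral_mono hi ((hP T hT).const_mul _) h
      _ = _ := by rw [integral_const_mul, hPint T hT, mul_comm]
  have hAlim : Tendsto (fun T : ℕ => ∫ u, |(S T).indicator (g T) u
      - π θstar * Real.exp (-(1 / 2) * Q Hstar u)|) atTop (𝓝 0) := by
    have := tendsto_integral_filter_of_dominated_convergence (l := atTop) (μ := volume)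
      (F := fun (T : ℕ) u => |(S T).indicator (g T) u
      - π θstar * Real.exp (-(1 / 2) * Q Hstar u)|) (f := fun _ => 0)
      (fun u => (K + π θstar) * Real.exp (-l * ‖u‖ ^ 2)) ?_ ?_ (hgi.const_mul _) ?_
    · simpa using this
    · filter_upwards [hAi] with T h
      exact (h.sub (hGi.const_mul _)).abs.aestronglyMeasurable
    · filter_upwards [hAb] with T h
      refine ae_of_all _ fun u => ?_
      rw [Real.norm_eq_abs, abs_abs, add_mul]
      have h1 : π θstar * Real.exp (-(1 / 2) * Q Hstar u) ≤ π θstar * Real.exp (-l * ‖u‖ ^ 2) :=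
        mul_le_mul_of_nonneg_left (hG u) (hπ_nonneg _)
      have h2 : 0 ≤ π θstar * Real.exp (-(1 / 2) * Q Hstar u) :=
        mul_nonneg (hπ_nonneg _) (Real.exp_pos _).le
      have h3 := h u
      have h4 := hA0 T u
      rw [abs_le]
      constructor <;> linarith
    · refine ae_of_all _ fun u => ?_
      have hv : Tendsto (fun T : ℕ => ‖(Real.sqrt T)⁻¹ • u‖) atTop (𝓝 0) := by
        simpa using (hsq.smul_const u).norm
      have h1 := ((hlim u).sub_const (π θstar * Real.exp (-(1 / 2) * Q Hstar u))).abs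
      rw [sub_self, abs_zero] at h1
      refine h1.congr' ?_
      filter_upwards [hv.eventually_lt_const hε] with T hT
      rw [Set.indicator_of_mem (show u ∈ S T from hT)]
  refine ⟨hGi, ?_, ?_⟩
  · filter_upwards [hAi, hBi] with T h1 h2
    exact (h1.add h2).congr (ae_of_all _ fun u => (hdec T u).symm)
  · have h0 := hAlim.add hBlim
    rw [add_zero] at h0
    refine squeeze_zero' (Eventually.of_forall fun T => integral_nonneg fun _ => abs_nonneg _) ?_ h0
    filter_upwards [hAi, hBi] with T h1 h2
    have h3 : Integrable (fun u => |(S T).indicator (g T) u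
      - π θstar * Real.exp (-(1 / 2) * Q Hstar u)|) := (h1.sub (hGi.const_mul (π θstar))).abs
    rw [← integral_add h3 h2]
    refine integral_mono_of_nonneg (ae_of_all _ fun _ => abs_nonneg _) (h3.add h2)
      (ae_of_all _ fun u => ?_)
    change |g T u - _| ≤ |_| + _
    rw [hdec T u]
    have := abs_add_le ((S T).indicator (g T) u - π θstar * Real.exp (-(1 / 2) * Q Hstar u))
      ((S T)ᶜ.indicator (g T) u)
    rw [abs_of_nonneg (hB0 T u)] at this
    refine le_trans (le_of_eq ?_) this
    congr 1
    ring

end BvM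

/-- **Theorem 1, part (iii)** (Bernstein–von Mises: asymptotic normality in total variation).
Under the prior conditions on `π`, the quadratic representation (M1) and the separation
condition (M2), the density `q_T(u) = T^{−p/2} · π_T(θ̂_T + u/√T)` of `√T(θ − θ̂_T)` under
the generalized posterior `π_T(θ) = π(θ) exp(−T·L_T(θ))/z_T` converges in `L¹` (total
variation) to the density of `𝒩(0, (H*)⁻¹)`, namely
`u ↦ √(det H* / (2π)^p) · exp(−½ uᵀ H* u)`. -/
theorem stmt_6 {p : ℕ} (θstar : EuclideanSpace ℝ (Fin p))
    (π : EuclideanSpace ℝ (Fin p) → ℝ)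
    (hπ_nonneg : ∀ θ, 0 ≤ π θ)
    (hπ_prob : ∫ θ, π θ = 1)
    (hπ_cont : ContinuousAt π θstar)
    (hπ_pos : 0 < π θstar)
    (L : ℕ → EuclideanSpace ℝ (Fin p) → ℝ)
    (hL_cont : ∀ T, Continuous (L T))
    -- (M1): quadratic representation with cubic remainder
    (θhat : ℕ → EuclideanSpace ℝ (Fin p))
    (hθhat : Tendsto θhat atTop (𝓝 θstar))
    (H : ℕ → Matrix (Fin p) (Fin p) ℝ) (Hstar : Matrix (Fin p) (Fin p) ℝ)
    (hH_symm : ∀ T, (H T).IsSymm)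
    (hH_lim : Tendsto H atTop (𝓝 Hstar))
    (hHstar_posdef : Hstar.PosDef)
    (r : ℕ → EuclideanSpace ℝ (Fin p) → ℝ)
    (hrep : ∀ T θ, L T θ = L T (θhat T)
      + (1 / 2) * (∑ i, ∑ j, (θ - θhat T) i * H T i j * (θ - θhat T) j)
      + r T (θ - θhat T))
    (hrem : ∃ ε₀ > (0 : ℝ), ∃ c₀ > (0 : ℝ), ∀ᶠ T in atTop,
      ∀ u : EuclideanSpace ℝ (Fin p), ‖u‖ < ε₀ → |r T u| ≤ c₀ * ‖u‖ ^ 3)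
    -- (M2): separation condition
    (hsep : ∀ ε > (0 : ℝ), ∃ δ > (0 : ℝ), ∀ᶠ T in atTop,
      ∀ θ : EuclideanSpace ℝ (Fin p), ε ≤ ‖θ - θhat T‖ → δ ≤ L T θ - L T (θhat T))
    -- the normalizing constant, the generalized posterior and the rescaled density
    (z : ℕ → ℝ) (hz : ∀ T, z T = ∫ θ, Real.exp (-(T * L T θ)) * π θ)
    (πT : ℕ → EuclideanSpace ℝ (Fin p) → ℝ)
    (hπT : ∀ T θ, πT T θ = π θ * Real.exp (-(T * L T θ)) / z T)
    (q : ℕ → EuclideanSpace ℝ (Fin p) → ℝ)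
    (hq : ∀ (T : ℕ) (u : EuclideanSpace ℝ (Fin p)),
      q T u = (T : ℝ) ^ (-(p : ℝ) / 2) * πT T (θhat T + (Real.sqrt T)⁻¹ • u)) :
    Tendsto
      (fun T : ℕ => ∫ u : EuclideanSpace ℝ (Fin p),
        |q T u - Real.sqrt (Hstar.det / (2 * Real.pi) ^ p)
          * Real.exp (-(1 / 2) * ∑ i, ∑ j, u i * Hstar i j * u j)|)
      atTop (𝓝 0) := by
  classical
  have hcI := BvM.integral_gauss hHstar_posdef
  let D : ℕ → EuclideanSpace ℝ (Fin p) → ℝ := fun T v => L T (θhat T + v) - L T (θhat T)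
  have hDc : ∀ T, Continuous (D T) := fun T => by
    have := hL_cont T
    fun_prop
  have hDrep : ∀ T v, D T v = (1 / 2) * BvM.Q (H T) v + r T v := by
    intro T v
    simp only [D, BvM.Q]
    rw [hrep T (θhat T + v)]
    simp only [add_sub_cancel_left]
    ring
  have hDsep : ∀ ε > (0 : ℝ), ∃ δ > (0 : ℝ), ∀ᶠ T in atTop,
      ∀ v : EuclideanSpace ℝ (Fin p), ε ≤ ‖v‖ → δ ≤ D T v := by
    intro ε hε
    obtain ⟨δ, hδ, h⟩ := hsep ε hε
    refine ⟨δ, hδ, ?_⟩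
    filter_upwards [h] with T hT v hv
    exact hT _ (by simpa using hv)
  obtain ⟨hGi, hgi, hlim⟩ := BvM.core hπ_nonneg hπ_prob hπ_cont hDc hθhat hH_lim hHstar_posdef
    hDrep hrem hDsep
  set c := Real.sqrt (Hstar.det / (2 * Real.pi) ^ p) with hc
  set g : ℕ → EuclideanSpace ℝ (Fin p) → ℝ := fun T u => π (θhat T + (Real.sqrt T)⁻¹ • u) *
        Real.exp (-(T * D T ((Real.sqrt T)⁻¹ • u))) with hg
  set G : EuclideanSpace ℝ (Fin p) → ℝ := fun u => Real.exp (-(1 / 2) * BvM.Q Hstar u) with hGdef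
  set I := ∫ u, G u with hI
  have hI0 : I ≠ 0 := fun h => by
    rw [h, mul_zero] at hcI
    exact zero_ne_one hcI
  -- convergence of the normalising constants
  have hZ : Tendsto (fun T => ∫ u, g T u) atTop (𝓝 (π θstar * I)) := by
    rw [tendsto_iff_dist_tendsto_zero]
    refine squeeze_zero' (Eventually.of_forall fun _ => dist_nonneg) ?_ hlim
    filter_upwards [hgi] with T h
    rw [Real.dist_eq, hI, ← integral_const_mul, ← integral_sub h (hGi.const_mul _)]
    exact abs_integral_le_integral_abs
  have hlim0 : π θstar * I ≠ 0 := mul_ne_zero hπ_pos.ne' hI0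
  have hqg : ∀ T : ℕ, 1 ≤ T → ∀ u, q T u = g T u / ∫ u, g T u := by
    intro T hT u
    have hT' : (0 : ℝ) < T := by exact_mod_cast hT
    have hgT : ∀ u, g T u = Real.exp (T * L T (θhat T)) *
        (Real.exp (-(T * L T (θhat T + (Real.sqrt T)⁻¹ • u))) *
          π (θhat T + (Real.sqrt T)⁻¹ • u)) := by
      intro u
      rw [← mul_assoc, ← Real.exp_add, mul_comm]
      simp only [hg, D]
      have : -((T : ℝ) * (L T (θhat T + (Real.sqrt T)⁻¹ • u) - L T (θhat T)))
        = T * L T (θhat T) + -(T * L T (θhat T + (Real.sqrt T)⁻¹ • u)) := by ring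
      rw [this]
    have hZT : ∫ u, g T u = Real.exp (T * L T (θhat T)) * ((T : ℝ) ^ ((p : ℝ) / 2) * z T) := by
      simp only [hgT]
      rw [integral_const_mul, Measure.integral_comp_inv_smul volume
        (fun v => Real.exp (-(T * L T (θhat T + v))) * π (θhat T + v)),
        integral_add_left_eq_self (fun v => Real.exp (-(T * L T v)) * π v), ← hz,
        finrank_euclideanSpace_fin, smul_eq_mul,
        abs_of_nonneg (by positivity), Real.sqrt_eq_rpow, ← Real.rpow_natCast,
        ← Real.rpow_mul (by positivity)]
      have : 1 / 2 * (p : ℝ) = p / 2 := by ring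
      rw [this]
    rw [hZT, hgT, mul_div_mul_left _ _ (Real.exp_pos _).ne', hq, hπT, neg_div,
      Real.rpow_neg hT'.le, div_mul_eq_div_div, mul_comm (π _)]
    have : (T : ℝ) ^ ((p : ℝ) / 2) ≠ 0 := (Real.rpow_pos_of_pos hT' _).ne'
    rw [div_right_comm, inv_mul_eq_div]
  have hfin : Tendsto (fun T : ℕ => |(∫ u, g T u)⁻¹| * (∫ u, |g T u - π θstar * G u|)
      + |(∫ u, g T u)⁻¹ - (π θstar * I)⁻¹| * (π θstar * I)) atTop (𝓝 0) := by
    have h1 := hZ.inv₀ hlim0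
    have hlim' : Tendsto (fun T : ℕ => ∫ u, |g T u - π θstar * G u|) atTop (𝓝 0) := hlim
    have h2 := (h1.abs.mul hlim').add
      ((h1.sub_const ((π θstar * I)⁻¹)).abs.mul_const (π θstar * I))
    simpa using h2
  refine squeeze_zero' (Eventually.of_forall fun T => integral_nonneg fun _ => abs_nonneg _) ?_ hfin
  filter_upwards [hgi, eventually_ge_atTop 1] with T hgT hT
  have hi1 : Integrable (fun u => |(∫ u, g T u)⁻¹| * |g T u - π θstar * G u|) :=
    (hgT.sub (hGi.const_mul _)).abs.const_mul _
  have hi2 : Integrable (fun u => |(∫ u, g T u)⁻¹ - (π θstar * I)⁻¹| * (π θstar * G u)) :=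
    (hGi.const_mul _).const_mul _
  have e : |(∫ u, g T u)⁻¹| * (∫ u, |g T u - π θstar * G u|)
      + |(∫ u, g T u)⁻¹ - (π θstar * I)⁻¹| * (π θstar * I)
      = ∫ u, (|(∫ u, g T u)⁻¹| * |g T u - π θstar * G u|
        + |(∫ u, g T u)⁻¹ - (π θstar * I)⁻¹| * (π θstar * G u)) := by
    rw [integral_add hi1 hi2, integral_const_mul, integral_const_mul, integral_const_mul]
  rw [e]
  refine integral_mono_of_nonneg (ae_of_all _ fun _ => abs_nonneg _) (hi1.add hi2)
    (ae_of_all _ fun u => ?_)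
  change |q T u - c * G u| ≤ |(∫ u, g T u)⁻¹| * |g T u - π θstar * G u|
        + |(∫ u, g T u)⁻¹ - (π θstar * I)⁻¹| * (π θstar * G u)
  have hG0 : 0 ≤ π θstar * G u := mul_nonneg hπ_pos.le (Real.exp_pos _).le
  have hcG : c * G u = (π θstar * I)⁻¹ * (π θstar * G u) := by
    rw [eq_div_of_mul_eq hI0 hcI]
    have := hπ_pos.ne'
    field_simp
  rw [hqg T hT, hcG]
  have hab : |(∫ u, g T u)⁻¹ - (π θstar * I)⁻¹| * (π θstar * G u)
      = |((∫ u, g T u)⁻¹ - (π θstar * I)⁻¹) * (π θstar * G u)| := by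
    rw [abs_mul, abs_of_nonneg hG0]
  rw [hab, ← abs_mul]
  refine le_trans (le_of_eq ?_) (abs_add_le _ _)
  congr 1
  ring
end
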